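/- The operation ✶ on L is associative: for all f, g, h ∈ L, (f✶g)✶h = f✶(g✶h). -/

import Mathlib

noncomputable section

attribute [local instance] Classical.propDecidable

instance : Fact ((0:ℝ) ≤ 1) := ⟨zero_le_one⟩

/-- The unit interval `I = [0,1]`. -/
abbrev I01 := unitInterval

/-- `f^L (x) = sup {f y | y ≤ x}`. -/
def funL (f : I01 → I01) (x : I01) : I01 := sSup (f '' {y | y ≤ x})

/-- `f^R (x) = sup {f y | y ≥ x}`. -/
def funR (f : I01 → I01) (x : I01) : I01 := sSup (f '' {y | x ≤ y})

/-- `f^{Lw}`. -/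
def funLw (f : I01 → I01) (x : I01) : I01 :=
  if x = 0 then f 0 else sSup (f '' {y | y < x})

/-- A function is normal if `sup {f x | x ∈ I} = 1`. -/
def NormalFn (f : I01 → I01) : Prop := sSup (Set.range f) = 1

/-- A function is convex in the fuzzy sense. -/
def ConvexFn (f : I01 → I01) : Prop :=
  ∀ x y z : I01, x ≤ y → y ≤ z → min (f x) (f z) ≤ f y

/-- `L`, the set of all normal and convex functions from `I` to `I`. -/
def NC : Set (I01 → I01) := {f | NormalFn f ∧ ConvexFn f}

/-- Characteristic function of a subset of `I`. -/
def ind (B : Set I01) : I01 → I01 := fun x => if x ∈ B then 1 else 0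

/-- `(f ⊓ g)(x) = sup {min (f y) (g z) | min y z = x}`. -/
def meet (f g : I01 → I01) : I01 → I01 := fun x =>
  sSup {v | ∃ y z : I01, min y z = x ∧ v = min (f y) (g z)}

/-- The partial order `f ⊑ g` iff `f ⊓ g = f`. -/
def sqle (f g : I01 → I01) : Prop := meet f g = f

/-- `η_{f,g}`. -/
def etaLG (f g : I01 → I01) : I01 :=
  min (sInf {x | funL f x = 1}) (sInf {x | funL g x = 1})

/-- `ξ_{f,g}`. -/
def xiLG (f g : I01 → I01) : I01 :=
  min (sSup {x | funR f x = 1}) (sSup {x | funR g x = 1})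

/-- The operation `✶`. -/
def starOp (f g : I01 → I01) : I01 → I01 :=
  if f = ind {1} then g
  else if g = ind {1} then f
  else fun t =>
    if t < etaLG f g then max (funL f t) (funL g t)
    else if t < xiLG f g then 1
    else if t = xiLG f g then min (funR f (xiLG f g)) (funR g (xiLG f g))
    else 0

/-- A t-norm on `I`. -/
structure IsTnormI (op : I01 → I01 → I01) : Prop where
  comm : ∀ x y : I01, op x y = op y x
  assoc : ∀ x y z : I01, op (op x y) z = op x (op y z)
  mono : ∀ x y z : I01, x ≤ y → op x z ≤ op y z ∧ op z x ≤ op z y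
  one_op : ∀ x : I01, op 1 x = x
  op_one : ∀ x : I01, op x 1 = x

/-- A t-conorm on `I`. -/
structure IsTconormI (op : I01 → I01 → I01) : Prop where
  comm : ∀ x y : I01, op x y = op y x
  assoc : ∀ x y z : I01, op (op x y) z = op x (op y z)
  mono : ∀ x y z : I01, x ≤ y → op x z ≤ op y z ∧ op z x ≤ op z y
  zero_op : ∀ x : I01, op 0 x = x
  op_zero : ∀ x : I01, op x 0 = x

/-- The convolution operation `(f ⋏ g)(x) = sup {st (f y) (g z) | tri y z = x}`. -/
def conv (st tri : I01 → I01 → I01) (f g : I01 → I01) : I01 → I01 := fun x =>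
  sSup {v | ∃ y z : I01, tri y z = x ∧ v = st (f y) (g z)}

/-- Complementation `(¬ f)(x) = f (1 - x)`. -/
def negf (f : I01 → I01) : I01 → I01 := fun x => f (unitInterval.symm x)

/-- The dual operation `f ◇^∁ g = ¬((¬f) ◇ (¬g))`. -/
def dualOp (op : (I01 → I01) → (I01 → I01) → (I01 → I01)) :
    (I01 → I01) → (I01 → I01) → (I01 → I01) :=
  fun f g => negf (op (negf f) (negf g))

/-- A t-norm on `L` according to the basic axioms (O1)--(O4). -/
def IsTnormOnL (T : (I01 → I01) → (I01 → I01) → (I01 → I01)) : Prop :=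
  (∀ f ∈ NC, ∀ g ∈ NC, T f g = T g f) ∧
  (∀ f ∈ NC, ∀ g ∈ NC, ∀ h ∈ NC, T (T f g) h = T f (T g h)) ∧
  (∀ f ∈ NC, T f (ind {1}) = f) ∧
  (∀ f ∈ NC, ∀ g ∈ NC, ∀ h ∈ NC, sqle f g → sqle (T f h) (T g h))

/-- A t-conorm on `L` according to the basic axioms (O1), (O2), (O3'), (O4). -/
def IsTconormOnL (S : (I01 → I01) → (I01 → I01) → (I01 → I01)) : Prop :=
  (∀ f ∈ NC, ∀ g ∈ NC, S f g = S g f) ∧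
  (∀ f ∈ NC, ∀ g ∈ NC, ∀ h ∈ NC, S (S f g) h = S f (S g h)) ∧
  (∀ f ∈ NC, S f (ind {0}) = f) ∧
  (∀ f ∈ NC, ∀ g ∈ NC, ∀ h ∈ NC, sqle f g → sqle (S f h) (S g h))

/-- A `t_r`-norm on `L`: an operation on `L` satisfying axioms (O1)--(O7). -/
def IsTrNorm (T : (I01 → I01) → (I01 → I01) → (I01 → I01)) : Prop :=
  (∀ f ∈ NC, ∀ g ∈ NC, T f g ∈ NC) ∧
  (∀ f ∈ NC, ∀ g ∈ NC, T f g = T g f) ∧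
  (∀ f ∈ NC, ∀ g ∈ NC, ∀ h ∈ NC, T (T f g) h = T f (T g h)) ∧
  (∀ f ∈ NC, T f (ind {1}) = f) ∧
  (∀ f ∈ NC, ∀ g ∈ NC, ∀ h ∈ NC, sqle f g → sqle (T f h) (T g h)) ∧
  (∀ a b : I01, a ≤ b → T (ind (Set.Icc 0 1)) (ind (Set.Icc a b)) = ind (Set.Icc 0 b)) ∧
  (∀ x₁ x₂ : I01, ∃ x₃ : I01, T (ind {x₁}) (ind {x₂}) = ind {x₃}) ∧
  (∀ a₁ b₁ a₂ b₂ : I01, a₁ ≤ b₁ → a₂ ≤ b₂ →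
    ∃ a₃ b₃ : I01, a₃ ≤ b₃ ∧
      T (ind (Set.Icc a₁ b₁)) (ind (Set.Icc a₂ b₂)) = ind (Set.Icc a₃ b₃))

/-- A `t_r`-conorm on `L`: an operation on `L` satisfying axioms
(O1), (O2), (O3'), (O4), (O5'), (O6), (O7). -/
def IsTrConorm (S : (I01 → I01) → (I01 → I01) → (I01 → I01)) : Prop :=
  (∀ f ∈ NC, ∀ g ∈ NC, S f g ∈ NC) ∧
  (∀ f ∈ NC, ∀ g ∈ NC, S f g = S g f) ∧
  (∀ f ∈ NC, ∀ g ∈ NC, ∀ h ∈ NC, S (S f g) h = S f (S g h)) ∧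
  (∀ f ∈ NC, S f (ind {0}) = f) ∧
  (∀ f ∈ NC, ∀ g ∈ NC, ∀ h ∈ NC, sqle f g → sqle (S f h) (S g h)) ∧
  (∀ a b : I01, a ≤ b → S (ind (Set.Icc 0 1)) (ind (Set.Icc a b)) = ind (Set.Icc a 1)) ∧
  (∀ x₁ x₂ : I01, ∃ x₃ : I01, S (ind {x₁}) (ind {x₂}) = ind {x₃}) ∧
  (∀ a₁ b₁ a₂ b₂ : I01, a₁ ≤ b₁ → a₂ ≤ b₂ →
    ∃ a₃ b₃ : I01, a₃ ≤ b₃ ∧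
      S (ind (Set.Icc a₁ b₁)) (ind (Set.Icc a₂ b₂)) = ind (Set.Icc a₃ b₃))

/-- The left endpoint `inf {x | f^L x = 1}`. -/
def leftEnd (f : I01 → I01) : I01 := sInf {x | funL f x = 1}

/-- The right endpoint `sup {x | f^R x = 1}`. -/
def rightEnd (f : I01 → I01) : I01 := sSup {x | funR f x = 1}

lemma etaLG_eq (f g : I01 → I01) : etaLG f g = min (leftEnd f) (leftEnd g) := rfl

lemma xiLG_eq (f g : I01 → I01) : xiLG f g = min (rightEnd f) (rightEnd g) := rfl

lemma le_funL (f : I01 → I01) {x y : I01} (h : y ≤ x) : f y ≤ funL f x :=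
  le_sSup ⟨y, h, rfl⟩

lemma le_funR (f : I01 → I01) {x y : I01} (h : x ≤ y) : f y ≤ funR f x :=
  le_sSup ⟨y, h, rfl⟩

lemma funL_le {f : I01 → I01} {x c : I01} (h : ∀ y ≤ x, f y ≤ c) : funL f x ≤ c :=
  sSup_le (by rintro _ ⟨y, hy, rfl⟩; exact h y hy)

lemma funR_le {f : I01 → I01} {x c : I01} (h : ∀ y, x ≤ y → f y ≤ c) : funR f x ≤ c :=
  sSup_le (by rintro _ ⟨y, hy, rfl⟩; exact h y hy)

lemma funL_mono (f : I01 → I01) : Monotone (funL f) := fun _ _ h =>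
  funL_le fun _ hz => le_funL f (hz.trans h)

lemma funR_anti (f : I01 → I01) : Antitone (funR f) := fun _ _ h =>
  funR_le fun _ hz => le_funR f (h.trans hz)

lemma le_one_I01 (x : I01) : x ≤ 1 := unitInterval.le_one'

lemma NormalFn.eq_one {f : I01 → I01} (hf : NormalFn f) {c : I01} (h : ∀ x, f x ≤ c) :
    c = 1 := by
  refine le_antisymm (le_one_I01 c) ?_
  rw [← hf]
  exact sSup_le (by rintro _ ⟨x, rfl⟩; exact h x)

lemma NormalFn.max_funL_funR {f : I01 → I01} (hf : NormalFn f) (x : I01) :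
    max (funL f x) (funR f x) = 1 :=
  hf.eq_one fun y => (le_total y x).elim
    (fun h => le_max_of_le_left (le_funL f h)) (fun h => le_max_of_le_right (le_funR f h))

lemma NormalFn.of_funL_eq_one {f : I01 → I01} {x : I01} (h : funL f x = 1) : NormalFn f := by
  refine le_antisymm (le_one_I01 _) ?_
  rw [← h]
  exact funL_le fun y _ => le_sSup ⟨y, rfl⟩

lemma funL_ne_one_of_lt {f : I01 → I01} {x : I01} (h : x < leftEnd f) : funL f x ≠ 1 :=
  fun hx => (sInf_le (a := x) hx).not_gt h

lemma funR_eq_one_of_lt {f : I01 → I01} {x : I01} (h : x < rightEnd f) : funR f x = 1 := by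
  obtain ⟨y, hy, hxy⟩ := lt_sSup_iff.1 h
  exact le_antisymm (le_one_I01 _) (hy.ge.trans (funR_anti f hxy.le))

lemma NormalFn.leftEnd_le_rightEnd {f : I01 → I01} (hf : NormalFn f) :
    leftEnd f ≤ rightEnd f := by
  refine le_of_forall_lt_imp_le_of_dense fun x hx => le_sSup ?_
  exact ((max_eq_iff.1 (hf.max_funL_funR x)).resolve_left
    fun h => funL_ne_one_of_lt hx h.1).1

section StarOp

variable {f g : I01 → I01}

lemma starOp_apply (hf₁ : f ≠ ind {1}) (hg₁ : g ≠ ind {1}) (t : I01) :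
    starOp f g t =
      if t < etaLG f g then max (funL f t) (funL g t)
      else if t < xiLG f g then 1
      else if t = xiLG f g then min (funR f (xiLG f g)) (funR g (xiLG f g))
      else 0 := by
  simp only [starOp, if_neg hf₁, if_neg hg₁]

lemma etaLG_le_xiLG (hf : NormalFn f) (hg : NormalFn g) : etaLG f g ≤ xiLG f g :=
  min_le_min hf.leftEnd_le_rightEnd hg.leftEnd_le_rightEnd

lemma starOp_of_lt_etaLG (hf₁ : f ≠ ind {1}) (hg₁ : g ≠ ind {1}) {t : I01}
    (ht : t < etaLG f g) : starOp f g t = max (funL f t) (funL g t) := by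
  rw [starOp_apply hf₁ hg₁, if_pos ht]

lemma starOp_of_lt_xiLG (hf₁ : f ≠ ind {1}) (hg₁ : g ≠ ind {1}) {t : I01}
    (ht : etaLG f g ≤ t) (ht' : t < xiLG f g) : starOp f g t = 1 := by
  rw [starOp_apply hf₁ hg₁, if_neg ht.not_gt, if_pos ht']

lemma starOp_xiLG (hf₁ : f ≠ ind {1}) (hg₁ : g ≠ ind {1}) (hf : NormalFn f)
    (hg : NormalFn g) :
    starOp f g (xiLG f g) = min (funR f (xiLG f g)) (funR g (xiLG f g)) := by
  rw [starOp_apply hf₁ hg₁, if_neg (etaLG_le_xiLG hf hg).not_gt, if_neg (lt_irrefl _),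
    if_pos rfl]

lemma starOp_of_xiLG_lt (hf₁ : f ≠ ind {1}) (hg₁ : g ≠ ind {1}) (hf : NormalFn f)
    (hg : NormalFn g) {t : I01} (ht : xiLG f g < t) : starOp f g t = 0 := by
  rw [starOp_apply hf₁ hg₁, if_neg ((etaLG_le_xiLG hf hg).trans ht.le).not_gt,
    if_neg ht.not_gt, if_neg ht.ne']

lemma funL_starOp_of_lt (hf₁ : f ≠ ind {1}) (hg₁ : g ≠ ind {1}) {t : I01}
    (ht : t < etaLG f g) : funL (starOp f g) t = max (funL f t) (funL g t) := by
  refine le_antisymm (funL_le fun y hy => ?_) ?_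
  · rw [starOp_of_lt_etaLG hf₁ hg₁ (hy.trans_lt ht)]
    exact max_le_max (funL_mono f hy) (funL_mono g hy)
  · rw [← starOp_of_lt_etaLG hf₁ hg₁ ht]
    exact le_funL _ le_rfl

lemma funL_starOp_etaLG (hf₁ : f ≠ ind {1}) (hg₁ : g ≠ ind {1}) (hf : NormalFn f)
    (hg : NormalFn g) : funL (starOp f g) (etaLG f g) = 1 := by
  have key : ∀ k : I01 → I01, NormalFn k → (∀ t, funL k t ≤ max (funL f t) (funL g t)) →
      funR k (etaLG f g) ≠ 1 → funL (starOp f g) (etaLG f g) = 1 := by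
    intro k hk hle hne
    have h : max (funL (starOp f g) (etaLG f g)) (funR k (etaLG f g)) = 1 := by
      refine hk.eq_one fun x => ?_
      rcases lt_or_ge x (etaLG f g) with hx | hx
      · refine le_max_of_le_left ((le_funL k le_rfl).trans ((hle x).trans ?_))
        rw [← starOp_of_lt_etaLG hf₁ hg₁ hx]
        exact le_funL _ hx.le
      · exact le_max_of_le_right (le_funR k hx)
    exact ((max_eq_iff.1 h).resolve_right fun h => hne h.1).1
  refine le_antisymm (le_one_I01 _) ?_
  rcases (etaLG_le_xiLG hf hg).lt_or_eq with hlt | heq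
  · rw [← starOp_of_lt_xiLG hf₁ hg₁ le_rfl hlt]
    exact le_funL _ le_rfl
  · by_cases h₁ : funR f (etaLG f g) = 1
    · by_cases h₂ : funR g (etaLG f g) = 1
      · have h := starOp_xiLG hf₁ hg₁ hf hg
        rw [← heq, h₁, h₂, min_self] at h
        rw [← h]
        exact le_funL _ le_rfl
      · exact (key g hg (fun t => le_max_right _ _) h₂).ge
    · exact (key f hf (fun t => le_max_left _ _) h₁).ge

lemma normalFn_starOp (hf₁ : f ≠ ind {1}) (hg₁ : g ≠ ind {1}) (hf : NormalFn f)
    (hg : NormalFn g) : NormalFn (starOp f g) :=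
  .of_funL_eq_one (funL_starOp_etaLG hf₁ hg₁ hf hg)

lemma funL_starOp_ne_one_of_lt (hf₁ : f ≠ ind {1}) (hg₁ : g ≠ ind {1}) {t : I01}
    (ht : t < etaLG f g) : funL (starOp f g) t ≠ 1 := by
  rw [funL_starOp_of_lt hf₁ hg₁ ht]
  intro h
  rcases max_eq_iff.1 h with h | h
  · exact funL_ne_one_of_lt (ht.trans_le (min_le_left _ _)) h.1
  · exact funL_ne_one_of_lt (ht.trans_le (min_le_right _ _)) h.1

lemma leftEnd_starOp (hf₁ : f ≠ ind {1}) (hg₁ : g ≠ ind {1}) (hf : NormalFn f)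
    (hg : NormalFn g) : leftEnd (starOp f g) = etaLG f g :=
  le_antisymm (sInf_le (funL_starOp_etaLG hf₁ hg₁ hf hg))
    (le_sInf fun _ hx => not_lt.1 fun h => funL_starOp_ne_one_of_lt hf₁ hg₁ h hx)

lemma funR_starOp (hf₁ : f ≠ ind {1}) (hg₁ : g ≠ ind {1}) (hf : NormalFn f)
    (hg : NormalFn g) {t : I01} (ht : t ≤ xiLG f g) :
    funR (starOp f g) t = min (funR f t) (funR g t) := by
  rcases ht.lt_or_eq with hlt | rfl
  · rw [funR_eq_one_of_lt (hlt.trans_le (min_le_left _ _)),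
      funR_eq_one_of_lt (hlt.trans_le (min_le_right _ _)), min_self]
    rcases lt_or_ge t (etaLG f g) with h | h
    · exact ((max_eq_iff.1 ((normalFn_starOp hf₁ hg₁ hf hg).max_funL_funR t)).resolve_left
        fun h' => funL_starOp_ne_one_of_lt hf₁ hg₁ h h'.1).1
    · refine le_antisymm (le_one_I01 _) ?_
      rw [← starOp_of_lt_xiLG hf₁ hg₁ h hlt]
      exact le_funR _ le_rfl
  · rw [← starOp_xiLG hf₁ hg₁ hf hg]
    refine le_antisymm (funR_le fun y hy => ?_) (le_funR _ le_rfl)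
    rcases hy.lt_or_eq with h | rfl
    · rw [starOp_of_xiLG_lt hf₁ hg₁ hf hg h]
      exact unitInterval.nonneg'
    · exact le_rfl

lemma rightEnd_starOp (hf₁ : f ≠ ind {1}) (hg₁ : g ≠ ind {1}) (hf : NormalFn f)
    (hg : NormalFn g) : rightEnd (starOp f g) = xiLG f g := by
  refine le_antisymm (sSup_le fun x hx => not_lt.1 fun h => ?_)
    (le_of_forall_lt_imp_le_of_dense fun x hx => le_sSup ?_)
  · have h0 : funR (starOp f g) x ≤ 0 := funR_le fun y hy =>
      (starOp_of_xiLG_lt hf₁ hg₁ hf hg (h.trans_le hy)).le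
    rw [show funR (starOp f g) x = 1 from hx] at h0
    exact h0.not_gt zero_lt_one
  · change funR (starOp f g) x = 1
    rw [funR_starOp hf₁ hg₁ hf hg hx.le,
      funR_eq_one_of_lt (hx.trans_le (min_le_left _ _)),
      funR_eq_one_of_lt (hx.trans_le (min_le_right _ _)), min_self]

lemma NormalFn.eq_ind_one (hf : NormalFn f) (h : ∀ t < 1, f t = 0) : f = ind {1} := by
  funext t
  rcases (le_one_I01 t).lt_or_eq with ht | rfl
  · simp [ind, h t ht, ht.ne]
  · have h₁ : f 1 = 1 := hf.eq_one fun x => by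
      rcases (le_one_I01 x).lt_or_eq with hx | rfl
      · rw [h x hx]
        exact unitInterval.nonneg'
      · exact le_rfl
    simp [ind, h₁]

lemma starOp_ne_ind_one (hf₁ : f ≠ ind {1}) (hg₁ : g ≠ ind {1}) (hf : NormalFn f)
    (hg : NormalFn g) : starOp f g ≠ ind {1} := by
  intro h
  have h0 : ∀ t < (1 : I01), starOp f g t = 0 := fun t ht => by simp [h, ind, ht.ne]
  have heta : etaLG f g = 1 := by
    refine le_antisymm (le_one_I01 _) (not_lt.1 fun hlt => ?_)
    have hL : funL (starOp f g) (etaLG f g) ≤ 0 := funL_le fun y hy =>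
      (h0 y (hy.trans_lt hlt)).le
    rw [funL_starOp_etaLG hf₁ hg₁ hf hg] at hL
    exact hL.not_gt zero_lt_one
  refine hf₁ (hf.eq_ind_one fun t ht => le_antisymm ?_ unitInterval.nonneg')
  rw [← h0 t ht, starOp_of_lt_etaLG hf₁ hg₁ (heta.symm ▸ ht)]
  exact le_max_of_le_left (le_funL f le_rfl)

end StarOp

/-- `✶` is associative on `L`. -/
theorem stmt10 (f g h : I01 → I01) (hf : f ∈ NC) (hg : g ∈ NC) (hh : h ∈ NC) :
    starOp (starOp f g) h = starOp f (starOp g h) := by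
  by_cases hf₁ : f = ind {1}
  · simp [starOp, hf₁]
  by_cases hg₁ : g = ind {1}
  · simp [starOp, hf₁, hg₁]
  by_cases hh₁ : h = ind {1}
  · simp only [starOp, hf₁, hg₁, hh₁, if_true, if_false]
    split_ifs with h' <;> simp_all
  have hfg := starOp_ne_ind_one hf₁ hg₁ hf.1 hg.1
  have hgh := starOp_ne_ind_one hg₁ hh₁ hg.1 hh.1
  have heta : etaLG (starOp f g) h = etaLG f (starOp g h) := by
    rw [etaLG_eq, etaLG_eq, leftEnd_starOp hf₁ hg₁ hf.1 hg.1,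
      leftEnd_starOp hg₁ hh₁ hg.1 hh.1, etaLG_eq, etaLG_eq, min_assoc]
  have hxi : xiLG (starOp f g) h = xiLG f (starOp g h) := by
    rw [xiLG_eq, xiLG_eq, rightEnd_starOp hf₁ hg₁ hf.1 hg.1,
      rightEnd_starOp hg₁ hh₁ hg.1 hh.1, xiLG_eq, xiLG_eq, min_assoc]
  have heta_fg : etaLG (starOp f g) h ≤ etaLG f g :=
    (min_le_left _ _).trans (leftEnd_starOp hf₁ hg₁ hf.1 hg.1).le
  have heta_gh : etaLG f (starOp g h) ≤ etaLG g h :=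
    (min_le_right _ _).trans (leftEnd_starOp hg₁ hh₁ hg.1 hh.1).le
  have hxi_fg : xiLG (starOp f g) h ≤ xiLG f g :=
    (min_le_left _ _).trans (rightEnd_starOp hf₁ hg₁ hf.1 hg.1).le
  have hxi_gh : xiLG f (starOp g h) ≤ xiLG g h :=
    (min_le_right _ _).trans (rightEnd_starOp hg₁ hh₁ hg.1 hh.1).le
  funext t
  rw [starOp_apply hfg hh₁, starOp_apply hf₁ hgh,
    funR_starOp hf₁ hg₁ hf.1 hg.1 hxi_fg, funR_starOp hg₁ hh₁ hg.1 hh.1 hxi_gh,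
    heta, hxi, min_assoc]
  split_ifs with ht
  · rw [funL_starOp_of_lt hf₁ hg₁ (ht.trans_le (heta ▸ heta_fg)),
      funL_starOp_of_lt hg₁ hh₁ (ht.trans_le heta_gh), max_assoc]
  all_goals rfl
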